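/- arXiv:2111.02261 — 2 statements merged into one kernel-verified Lean document; each statement's English description precedes it below -/
import Mathlib

section
/- (Disconnectedness of 𝒦_D.) The metric space (𝒦_D, d_H) of nonempty compact forward-invariant sets of the doubling map of the circle, equipped with the Hausdorff metric, is compact and totally disconnected. -/
open Filter Topology

/-- A forward-invariant set of the doubling map is invariant under multiplication by `2 ^ n`. -/
theorem two_pow_nsmul_mem_of_forward_invariant {G : Type*} [AddMonoid G] {K : Set G}
    (hK : (fun x => x + x) '' K ⊆ K) {x : G} (hx : x ∈ K) (n : ℕ) : 2 ^ n • x ∈ K := by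
  induction n with
  | zero => simpa using hx
  | succ n ih =>
    have h := hK (Set.mem_image_of_mem _ ih)
    rwa [← two_nsmul, ← mul_nsmul, ← pow_succ] at h

/-- Nonempty compact sets that are forward invariant under a continuous map form a closed set. -/
theorem isClosed_nonemptyCompacts_image_subset {X : Type*} [TopologicalSpace X] [T2Space X]
    {f : X → X} (hf : Continuous f) :
    IsClosed {K : TopologicalSpace.NonemptyCompacts X | f '' (K : Set X) ⊆ K} := by
  have h : IsClosed {K : TopologicalSpace.NonemptyCompacts X | K.map f hf ⊔ K = K} :=
    isClosed_eq (hf.nonemptyCompacts_map.sup continuous_id) continuous_id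
  convert h using 3 with K
  rw [sup_eq_right]
  rfl

/-- Every neighbourhood of a point `x` of the circle contains an open arc around `x`, whose
endpoints are mapped to `x` by some iterate of the doubling map. -/
theorem AddCircle.exists_isOpen_isClosed_two_pow_nsmul_mem {x : AddCircle (1 : ℝ)}
    {U : Set (AddCircle (1 : ℝ))} (hU : U ∈ 𝓝 x) :
    ∃ V C : Set (AddCircle (1 : ℝ)), IsOpen V ∧ IsClosed C ∧ x ∈ V ∧ V ⊆ C ∧ C ⊆ U ∧
      ∀ y ∈ C, ∃ n : ℕ, 2 ^ n • y ∈ V := by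
  obtain ⟨t, rfl⟩ := QuotientAddGroup.mk_surjective x
  have hcont : Continuous (fun s : ℝ => (s : AddCircle (1 : ℝ))) := AddCircle.continuous_mk' 1
  obtain ⟨ε, hε, hball⟩ := Metric.mem_nhds_iff.1 (hcont.continuousAt.preimage_mem_nhds hU)
  obtain ⟨n, hn⟩ := exists_pow_lt_of_lt_one (half_pos hε) (one_half_lt_one (α := ℝ))
  have hp : (0 : ℝ) < 2 ^ n := by positivity
  have hpε : 2 < ε * 2 ^ n := by
    rw [one_div, inv_pow, inv_lt_iff_one_lt_mul₀ hp] at hn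
    linarith
  obtain ⟨k, hk₁, hk₂⟩ : ∃ k : ℤ, (k : ℝ) < (2 ^ n - 1) * t ∧ (2 ^ n - 1) * t ≤ k + 1 :=
    ⟨⌈(2 ^ n - 1) * t⌉ - 1, by push_cast; linarith [Int.ceil_lt_add_one ((2 ^ n - 1) * t)],
      by push_cast; linarith [Int.le_ceil ((2 ^ n - 1) * t)]⟩
  have hend (j : ℤ) : 2 ^ n • (((t + j) / 2 ^ n : ℝ) : AddCircle (1 : ℝ)) = t := by
    rw [← AddCircle.coe_nsmul, nsmul_eq_mul]
    push_cast
    rw [mul_div_cancel₀ _ hp.ne', AddCircle.coe_add]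
    simp
  set a : ℝ := (t + k) / 2 ^ n with ha
  set b : ℝ := (t + (k + 2 : ℤ)) / 2 ^ n with hb
  have hat : a < t := by rw [ha, div_lt_iff₀ hp]; linarith
  have htb : t < b := by rw [hb, lt_div_iff₀ hp]; push_cast; linarith
  have hta : t - ε < a := by rw [ha, lt_div_iff₀ hp]; linarith
  have hbt : b < t + ε := by rw [hb, div_lt_iff₀ hp]; push_cast; linarith
  have htV : (t : AddCircle (1 : ℝ)) ∈ (fun s : ℝ => (s : AddCircle (1 : ℝ))) '' Set.Ioo a b :=
    ⟨t, ⟨hat, htb⟩, rfl⟩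
  refine ⟨(fun s : ℝ => (s : AddCircle (1 : ℝ))) '' Set.Ioo a b,
    (fun s : ℝ => (s : AddCircle (1 : ℝ))) '' Set.Icc a b,
    QuotientAddGroup.isOpenMap_coe _ isOpen_Ioo, (isCompact_Icc.image hcont).isClosed, htV,
    Set.image_mono Set.Ioo_subset_Icc_self, ?_, ?_⟩
  · rintro _ ⟨s, ⟨hs₁, hs₂⟩, rfl⟩
    refine hball ?_
    rw [Real.ball_eq_Ioo]
    exact ⟨by linarith, by linarith⟩
  · rintro _ ⟨s, hs, rfl⟩
    rcases Set.eq_endpoints_or_mem_Ioo_of_mem_Icc hs with rfl | rfl | hs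
    · exact ⟨n, (hend _).symm ▸ htV⟩
    · exact ⟨n, (hend _).symm ▸ htV⟩
    · exact ⟨0, by simpa using Set.mem_image_of_mem _ hs⟩

/-- the space of nonempty compact forward-invariant sets of the doubling
map of the circle, with the Hausdorff metric, is compact and totally disconnected. -/
theorem doubling_invariant_sets_compact_totally_disconnected :
    CompactSpace {K : TopologicalSpace.NonemptyCompacts (AddCircle (1 : ℝ)) //
        (fun x => x + x) '' (K : Set (AddCircle (1 : ℝ))) ⊆ (K : Set (AddCircle (1 : ℝ)))} ∧
    TotallyDisconnectedSpace {K : TopologicalSpace.NonemptyCompacts (AddCircle (1 : ℝ)) //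
        (fun x => x + x) '' (K : Set (AddCircle (1 : ℝ))) ⊆ (K : Set (AddCircle (1 : ℝ)))} := by
  refine ⟨isCompact_iff_compactSpace.1
    (isClosed_nonemptyCompacts_image_subset (by fun_prop)).isCompact, ?_⟩
  set 𝒦 := {K : TopologicalSpace.NonemptyCompacts (AddCircle (1 : ℝ)) //
    (fun x => x + x) '' (K : Set (AddCircle (1 : ℝ))) ⊆ (K : Set (AddCircle (1 : ℝ)))}
  have separate (K L : 𝒦) (h : ¬ (K.1 : Set (AddCircle (1 : ℝ))) ⊆ L.1) :
      ∃ S : Set 𝒦, IsClopen S ∧ K ∈ S ∧ L ∉ S := by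
    obtain ⟨x, hxK, hxL⟩ := Set.not_subset.1 h
    obtain ⟨V, C, hV, hC, hxV, hVC, hCL, hCV⟩ :=
      AddCircle.exists_isOpen_isClosed_two_pow_nsmul_mem
        (L.1.isCompact.isClosed.isOpen_compl.mem_nhds hxL)
    have hmeet : {M : 𝒦 | ((M.1 : Set (AddCircle (1 : ℝ))) ∩ V).Nonempty} =
        {M : 𝒦 | ((M.1 : Set (AddCircle (1 : ℝ))) ∩ C).Nonempty} := by
      ext M
      refine ⟨fun hM => hM.mono (Set.inter_subset_inter_right _ hVC), ?_⟩
      rintro ⟨y, hyM, hyC⟩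
      obtain ⟨n, hn⟩ := hCV y hyC
      exact ⟨_, two_pow_nsmul_mem_of_forward_invariant M.2 hyM n, hn⟩
    refine ⟨{M : 𝒦 | ((M.1 : Set (AddCircle (1 : ℝ))) ∩ V).Nonempty}, ⟨?_, ?_⟩,
      ⟨x, hxK, hxV⟩, ?_⟩
    · rw [hmeet]
      exact (TopologicalSpace.NonemptyCompacts.isClosed_inter_nonempty_of_isClosed hC).preimage
        continuous_subtype_val
    · exact (TopologicalSpace.NonemptyCompacts.isOpen_inter_nonempty_of_isOpen hV).preimage
        continuous_subtype_val
    · rintro ⟨y, hyL, hyV⟩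
      exact hCL (hVC hyV) hyL
  have : TotallySeparatedSpace 𝒦 := by
    refine totallySeparatedSpace_iff_exists_isClopen.2 fun K L hKL => ?_
    by_cases h : (K.1 : Set (AddCircle (1 : ℝ))) ⊆ L.1
    · have h' : ¬ (L.1 : Set (AddCircle (1 : ℝ))) ⊆ K.1 := fun h' =>
        hKL (Subtype.ext (SetLike.coe_injective (h.antisymm h')))
      obtain ⟨S, hS, hLS, hKS⟩ := separate L K h'
      exact ⟨Sᶜ, hS.compl, hKS, fun hL => hL hLS⟩
    · exact separate K L h
  infer_instance
end

section
/- Let X be a compact metric space, f : X → X continuous, and (g_n) a sequence of continuous maps g_n : X → X converging uniformly to f. Suppose (K_n) is a sequence of nonempty compact subsets of X with g_n(K_n) = K_n for every n, and K_n converges to a nonempty compact set S in the Hausdorff metric. Then f(S) = S. -/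
open Filter Topology

/-- if `g_n → f` uniformly on a compact metric space, `g_n(K_n) = K_n` for
nonempty compact sets `K_n`, and `K_n → S` in the Hausdorff metric, then `f(S) = S`. -/
theorem limit_of_invariant_sets {X : Type*} [MetricSpace X] [CompactSpace X]
    (f : X → X) (hf : Continuous f) (g : ℕ → X → X) (hg : ∀ n, Continuous (g n))
    (hunif : TendstoUniformly g f Filter.atTop)
    (K : ℕ → TopologicalSpace.NonemptyCompacts X) (S : TopologicalSpace.NonemptyCompacts X)
    (hK : ∀ n, g n '' (K n : Set X) = (K n : Set X))
    (hlim : Filter.Tendsto K Filter.atTop (nhds S)) :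
    f '' (S : Set X) = (S : Set X) := by
  have hmap : Tendsto (fun n => (K n).map f hf) atTop (𝓝 (S.map f hf)) :=
    (hf.nonemptyCompacts_map.tendsto S).comp hlim
  have hdist : Tendsto (fun n => dist (K n) ((K n).map f hf)) atTop (𝓝 0) := by
    rw [Metric.tendsto_nhds]
    intro ε hε
    filter_upwards [Metric.tendstoUniformly_iff.1 hunif (ε / 2) (half_pos hε)] with n hn
    rw [Real.dist_0_eq_abs, abs_of_nonneg dist_nonneg, Metric.NonemptyCompacts.dist_eq,
      TopologicalSpace.NonemptyCompacts.coe_map]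
    refine (Metric.hausdorffDist_le_of_mem_dist (half_pos hε).le ?_ ?_).trans_lt (half_lt_self hε)
    · intro y hy
      rw [← hK n] at hy
      obtain ⟨x, hx, rfl⟩ := hy
      exact ⟨f x, Set.mem_image_of_mem f hx, by rw [dist_comm]; exact (hn x).le⟩
    · rintro _ ⟨x, hx, rfl⟩
      exact ⟨g n x, (hK n).subset (Set.mem_image_of_mem (g n) hx), (hn x).le⟩
  have heq : S.map f hf = S := tendsto_nhds_unique hmap (hlim.congr_dist hdist)
  rw [← TopologicalSpace.NonemptyCompacts.coe_map hf, heq]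
end
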